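/- Let m > n > 0 be integers and let F be a linear subspace of ℝ^m defined over the rationals, with d = dim F. Let τ₁, …, τ_n, β₁, …, β_n, ε be real numbers with τ_i > 0 for all i, ε > 0, τ₁ + … + τ_n ≤ d − n, and β₁ + … + β_n = (1+ε)(d − 1). Then for almost every n-tuple (e₁, …, e_n) ∈ F^n (with respect to the dn-dimensional Lebesgue measure on F^n) there exist constants c, C > 0 such that for every sufficiently large integer Q there exist m linearly independent vectors q^{(1)}, …, q^{(m)} ∈ ℤ^m satisfying, for every j ∈ {1,…,m}: ‖q^{(j)}‖ ≤ C·Q, and c·Q^{−τ_i}(log Q)^{β_i − (1+ε)d} ≤ |q^{(j)} · e_i| ≤ C·Q^{−τ_i}(log Q)^{β_i} for all i ∈ {1,…,n}. -/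

import Mathlib

open MeasureTheory Filter

/-- Supremum norm of an integer vector, as a real number. -/
noncomputable def supZ {k : ℕ} (q : Fin k → ℤ) : ℝ := ‖(fun i => (q i : ℝ))‖

/-- A subspace of `ℝ^m` is defined over the rationals if it is spanned by
vectors all of whose coordinates are rational. -/
def DefinedOverQ {m : ℕ} (F : Submodule ℝ (Fin m → ℝ)) : Prop :=
  ∃ B : Set (Fin m → ℝ), (∀ v ∈ B, ∀ i, ∃ a : ℚ, v i = (a : ℝ)) ∧ F = Submodule.span ℝ B


theorem slab {d : ℕ} (A η : ℝ) (hA : 0 ≤ A) (hη : 0 ≤ η) (q : Fin d → ℝ) (k : Fin d)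
    (hk : q k ≠ 0) :
    volume {v : Fin d → ℝ | (∀ j, |v j| ≤ A) ∧ |∑ j, q j * v j| ≤ η} ≤
      ENNReal.ofReal ((2 * A) ^ (d - 1) * (2 * η) / |q k|) := by
  classical
  set M : Matrix (Fin d) (Fin d) ℝ := (1 : Matrix (Fin d) (Fin d) ℝ).updateRow k q with hM
  have hdet : M.det = q k := by
    have := Matrix.cramer_transpose_apply (1 : Matrix (Fin d) (Fin d) ℝ) q k
    rw [Matrix.transpose_one, Matrix.cramer_one] at this
    simpa [hM] using this.symm
  have hdet' : LinearMap.det (Matrix.toLin' M) = q k := by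
    rw [LinearMap.det_toLin', hdet]
  have hsub : {v : Fin d → ℝ | (∀ j, |v j| ≤ A) ∧ |∑ j, q j * v j| ≤ η} ⊆
      (Matrix.toLin' M) ⁻¹' (Set.Icc (Function.update (fun _ => -A) k (-η))
        (Function.update (fun _ => A) k η)) := by
    rintro v ⟨h1, h2⟩
    have hval : ∀ j, Matrix.toLin' M v j = if j = k then ∑ j, q j * v j else v j := by
      intro j
      rw [Matrix.toLin'_apply]
      by_cases h : j = k
      · subst h; simp [hM, Matrix.mulVec, dotProduct]
      · simp [hM, Matrix.mulVec, dotProduct, h, Matrix.one_apply]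
    simp only [Set.mem_preimage, Set.mem_Icc, Pi.le_def, hval]
    constructor <;> intro j <;> by_cases h : j = k
    · subst h; simpa using (abs_le.1 h2).1
    · simpa [h] using (abs_le.1 (h1 j)).1
    · subst h; simpa using (abs_le.1 h2).2
    · simpa [h] using (abs_le.1 (h1 j)).2
  refine (measure_mono hsub).trans ?_
  rw [Measure.addHaar_preimage_linearMap _ (by rw [hdet']; exact hk), hdet', Real.volume_Icc_pi,
    ← ENNReal.ofReal_prod_of_nonneg, ← ENNReal.ofReal_mul (abs_nonneg _)]
  · apply le_of_eq
    congr 1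
    rw [← Finset.mul_prod_erase _ _ (Finset.mem_univ k)]
    rw [Finset.prod_congr rfl (g := fun _ => 2 * A)]
    · simp [abs_inv]; ring
    · intro j hj
      simp [Finset.ne_of_mem_erase hj]; ring
  · intro j _
    by_cases h : j = k
    · subst h; simp; linarith
    · simp [h]; linarith

theorem slabs {d n : ℕ} (A : ℝ) (η : Fin n → ℝ) (hA : 0 ≤ A) (hη : ∀ i, 0 ≤ η i) (q : Fin d → ℝ)
    (k : Fin d) (hk : q k ≠ 0) :
    volume {e : Fin n → Fin d → ℝ | ∀ i, (∀ j, |e i j| ≤ A) ∧ |∑ j, q j * e i j| ≤ η i} ≤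
      ENNReal.ofReal (((2 * A) ^ (d - 1) * 2) ^ n * (∏ i, η i) / |q k| ^ n) := by
  have : {e : Fin n → Fin d → ℝ | ∀ i, (∀ j, |e i j| ≤ A) ∧ |∑ j, q j * e i j| ≤ η i} =
      Set.pi Set.univ (fun i => {v : Fin d → ℝ | (∀ j, |v j| ≤ A) ∧ |∑ j, q j * v j| ≤ η i}) := by
    ext e; simp
  rw [this, volume_pi_pi]
  refine (Finset.prod_le_prod' (fun i _ => slab A (η i) hA (hη i) q k hk)).trans ?_
  rw [← ENNReal.ofReal_prod_of_nonneg]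
  · apply ENNReal.ofReal_le_ofReal
    apply le_of_eq
    rw [Finset.prod_div_distrib, Finset.prod_mul_distrib, Finset.prod_mul_distrib]
    simp; ring
  · intro i _
    have := hη i
    positivity

theorem invsum (d n : ℕ) (hnd : n < d) (N : ℕ) :
    ∑ q ∈ (Finset.Icc (fun _ => -(N:ℤ)) (fun _ => (N:ℤ)) : Finset (Fin d → ℤ)).erase 0,
      (1 / ‖q‖ ^ n) ≤ (2 * d * 3 ^ (d - 1)) * (N:ℝ) ^ (d - n) := by
  classical
  induction N with
  | zero =>
    have : (Finset.Icc (fun _ => -((0:ℕ):ℤ)) (fun _ => ((0:ℕ):ℤ)) : Finset (Fin d → ℤ)).erase 0 = ∅ := by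
      ext q
      simp only [Finset.mem_erase, Finset.mem_Icc, Pi.le_def]
      simp
      intro h1 h2
      by_contra h3
      apply h1
      ext i
      have := h2 i
      simp at h3
      have := h3 i
      simp; omega
    rw [this]; simp
    positivity
  | succ N ih =>
    set I : ℕ → Finset (Fin d → ℤ) := fun N => Finset.Icc (fun _ => -(N:ℤ)) (fun _ => (N:ℤ)) with hI
    have hsub : I N ⊆ I (N+1) := by
      apply Finset.Icc_subset_Icc <;> intro i <;> simp 
    have hcard : ∀ N, ((I N).card : ℝ) = (2 * N + 1) ^ d := by
      intro N
      simp only [hI, Pi.card_Icc, Int.card_Icc]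
      rw [Finset.prod_const]
      simp
      congr 1
      have : ((N:ℤ) + 1 + N).toNat = 2 * N + 1 := by omega
      rw [this]; push_cast; ring
    have hsplit : (I (N+1)).erase 0 = ((I N).erase 0) ∪ (I (N+1) \ I N) := by
      ext q
      have h0 : (0 : Fin d → ℤ) ∈ I N := by simp [hI, Pi.le_def]
      simp only [Finset.mem_erase, Finset.mem_union, Finset.mem_sdiff]
      constructor
      · rintro ⟨h1, h2⟩
        by_cases h : q ∈ I N <;> simp [h, h1, h2]
      · rintro (⟨h1, h2⟩ | ⟨h1, h2⟩)
        · exact ⟨h1, hsub h2⟩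
        · exact ⟨fun h => h2 (h ▸ h0), h1⟩
    have hdisj : Disjoint ((I N).erase 0) (I (N+1) \ I N) :=
      Finset.disjoint_sdiff.mono_left (Finset.erase_subset _ _)
    rw [hsplit, Finset.sum_union hdisj]
    have hN1 : (0:ℝ) < (N:ℝ) + 1 := by positivity
    have hshell : ∀ q ∈ I (N+1) \ I N, 1 / ‖q‖ ^ n ≤ 1 / ((N:ℝ) + 1) ^ n := by
      intro q hq
      have : (N:ℝ) + 1 ≤ ‖q‖ := by
        by_contra hlt
        push Not at hlt
        apply (Finset.mem_sdiff.1 hq).2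
        have h := (pi_norm_lt_iff hN1).1 hlt
        have h' : ∀ i, |q i| < (N:ℤ) + 1 := by
          intro i
          have := h i
          rw [Int.norm_eq_abs] at this
          exact_mod_cast this
        simp only [hI, Finset.mem_Icc, Pi.le_def]
        constructor <;> intro i <;> have := abs_lt.1 (h' i) <;> omega
      gcongr
    have hc : ((I (N+1) \ I N).card : ℝ) ≤ 2 * d * 3 ^ (d-1) * ((N:ℝ)+1)^(d-1) := by
      rw [Finset.card_sdiff_of_subset hsub, Nat.cast_sub (Finset.card_le_card hsub), hcard, hcard]
      push_cast
      have h1 : (2 * ((N:ℝ)+1) + 1) ≤ 3 * ((N:ℝ)+1) := by linarith [(Nat.cast_nonneg N : (0:ℝ) ≤ N)]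
      have key : (2 * ((N:ℝ)+1) + 1)^d - (2 * N + 1)^d ≤ 2 * d * (2 * ((N:ℝ)+1) + 1)^(d-1) := by
        have := abs_pow_sub_pow_le (2 * ((N:ℝ)+1) + 1) (2 * N + 1) d
        have h2 := (le_abs_self _).trans this
        refine h2.trans (le_of_eq ?_)
        have e1 : |2 * ((N:ℝ)+1) + 1 - (2 * N + 1)| = 2 := by
          rw [show 2 * ((N:ℝ)+1) + 1 - (2 * N + 1) = 2 by ring]; simp
        rw [e1, abs_of_nonneg (by positivity), abs_of_nonneg (by positivity), max_eq_left (by linarith)]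
      calc _ ≤ _ := key
        _ ≤ 2 * d * (3 * ((N:ℝ)+1))^(d-1) := by gcongr
        _ = _ := by rw [mul_pow]; ring
    have h2 : ∑ q ∈ I (N+1) \ I N, 1 / ‖q‖ ^ n ≤ 2 * d * 3 ^ (d-1) * ((N:ℝ)+1)^(d-1-n) := by
      refine (Finset.sum_le_card_nsmul _ _ _ hshell).trans ?_
      rw [nsmul_eq_mul, mul_one_div, div_le_iff₀ (by positivity), mul_assoc, ← pow_add,
        Nat.sub_add_cancel (by omega)]
      exact hc
    obtain ⟨p, hp⟩ : ∃ p, d - n = p + 1 := ⟨d - n - 1, by omega⟩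
    have hp' : d - 1 - n = p := by omega
    rw [hp'] at h2
    rw [hp] at ih ⊢
    push_cast
    have h3 : (N:ℝ)^(p+1) + ((N:ℝ)+1)^p ≤ ((N:ℝ)+1)^(p+1) := by
      have : (N:ℝ)^p ≤ ((N:ℝ)+1)^p := by gcongr; linarith
      rw [pow_succ, pow_succ]
      nlinarith [(Nat.cast_nonneg N : (0:ℝ) ≤ N)]
    calc _ ≤ _ := add_le_add ih h2
      _ = (2 * d * 3 ^ (d - 1)) * ((N:ℝ)^(p+1) + ((N:ℝ)+1)^p) := by ring
      _ ≤ _ := by gcongr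


theorem exists_coord_norm {d : ℕ} (q : Fin d → ℤ) (hq : q ≠ 0) : ∃ k, ‖q‖ = |(q k : ℝ)| ∧ q k ≠ 0 := by
  obtain ⟨k0, hk0⟩ := Function.ne_iff.1 hq
  have : Nonempty (Fin d) := ⟨k0⟩
  obtain ⟨k, hk⟩ := Finite.exists_max (fun k => ‖q k‖)
  have h1 : ‖q‖ = ‖q k‖ := le_antisymm ((pi_norm_le_iff_of_nonneg (norm_nonneg _)).2 hk) (norm_le_pi_norm q k)
  refine ⟨k, by rw [h1, Int.norm_eq_abs], ?_⟩
  intro h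
  have := hk k0
  simp [h] at this
  exact hk0 this

theorem bc {d n : ℕ} (hnd : n < d) (N : ℕ → ℝ) (η : ℕ → Fin n → ℝ) (hN : ∀ k, 0 ≤ N k)
    (hη : ∀ k i, 0 ≤ η k i) (hs : Summable fun k => N k ^ (d - n) * ∏ i, η k i) :
    ∀ᵐ e : Fin n → Fin d → ℝ, ∀ᶠ k in atTop, ∀ q : Fin d → ℤ, q ≠ 0 → ‖q‖ ≤ N k →
      ∃ i, η k i < |∑ j, (q j : ℝ) * e i j| := by
  classical
  set I : ℕ → Finset (Fin d → ℤ) := fun N =>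
    (Finset.Icc (fun _ => -(N:ℤ)) (fun _ => (N:ℤ)) : Finset (Fin d → ℤ)).erase 0 with hI
  set s : ℕ → ℕ → Set (Fin n → Fin d → ℝ) := fun A k => ⋃ q ∈ I ⌊N k⌋₊,
    {e : Fin n → Fin d → ℝ | ∀ i, (∀ j, |e i j| ≤ (A:ℝ)) ∧ |∑ j, (q j:ℝ) * e i j| ≤ η k i} with hsdef
  have hmeas : ∀ A k, volume (s A k) ≤ ENNReal.ofReal
      (((2 * (A:ℝ)) ^ (d - 1) * 2) ^ n * (2 * d * 3 ^ (d - 1)) * (N k ^ (d - n) * ∏ i, η k i)) := by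
    intro A k
    have hP : 0 ≤ ∏ i, η k i := Finset.prod_nonneg fun i _ => hη k i
    refine (measure_biUnion_finset_le _ _).trans ?_
    have h1 : ∀ q ∈ I ⌊N k⌋₊, volume {e : Fin n → Fin d → ℝ | ∀ i, (∀ j, |e i j| ≤ (A:ℝ)) ∧
        |∑ j, (q j:ℝ) * e i j| ≤ η k i} ≤
        ENNReal.ofReal ((((2 * (A:ℝ)) ^ (d - 1) * 2) ^ n * (∏ i, η k i)) * (1 / ‖q‖ ^ n)) := by
      intro q hq
      obtain ⟨j, hj, hj0⟩ := exists_coord_norm q (Finset.ne_of_mem_erase hq)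
      have := slabs (A:ℝ) (η k) (by positivity) (hη k) (fun j => (q j : ℝ)) j (by exact_mod_cast hj0)
      rw [hj, mul_one_div]
      exact this
    refine (Finset.sum_le_sum h1).trans ?_
    rw [← ENNReal.ofReal_sum_of_nonneg (fun q _ => by positivity), ← Finset.mul_sum]
    apply ENNReal.ofReal_le_ofReal
    have h2 := invsum d n hnd ⌊N k⌋₊
    have h3 : (⌊N k⌋₊ : ℝ) ^ (d-n) ≤ N k ^ (d-n) := by
      gcongr
      exact Nat.floor_le (hN k)
    calc _ ≤ ((2 * (A:ℝ)) ^ (d - 1) * 2) ^ n * (∏ i, η k i) * ((2 * d * 3 ^ (d - 1)) * N k ^ (d-n)) := by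
          gcongr
          exact h2.trans (by gcongr)
      _ = _ := by ring
  have hae : ∀ A : ℕ, ∀ᵐ e : Fin n → Fin d → ℝ, ∀ᶠ k in atTop, e ∉ s A k := by
    intro A
    apply ae_eventually_notMem
    have hsum := (hs.mul_left (((2 * (A:ℝ)) ^ (d - 1) * 2) ^ n * (2 * d * 3 ^ (d - 1))))
    exact ne_top_of_le_ne_top hsum.tsum_ofReal_ne_top (ENNReal.tsum_le_tsum (hmeas A))
  filter_upwards [ae_all_iff.2 hae] with e he
  obtain ⟨A, hA⟩ := exists_nat_ge ‖e‖
  filter_upwards [he A] with k hk q hq hqN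
  by_contra! hcon
  apply hk
  simp only [hsdef, Set.mem_iUnion]
  refine ⟨q, ?_, fun i => ⟨fun j => ?_, hcon i⟩⟩
  · simp only [hI, Finset.mem_erase, Finset.mem_Icc, Pi.le_def]
    refine ⟨hq, ?_⟩
    have : ∀ i, |q i| ≤ (⌊N k⌋₊ : ℤ) := by
      intro i
      have h1 := (norm_le_pi_norm q i).trans hqN
      rw [Int.norm_eq_abs] at h1
      have h2 : ((q i).natAbs : ℝ) ≤ N k := by
        rw [Nat.cast_natAbs]; exact_mod_cast h1
      have := Nat.le_floor h2
      rw [Int.abs_eq_natAbs]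
      exact_mod_cast this
    exact ⟨fun i => (abs_le.1 (this i)).1, fun i => (abs_le.1 (this i)).2⟩
  · exact ((norm_le_pi_norm (e i) j).trans (norm_le_pi_norm e i)).trans hA

open Metric in
theorem packing {E : Type*} [NormedAddCommGroup E] [NormedSpace ℝ E] [FiniteDimensional ℝ E]
    (s : Finset E) (r : ℝ) (hr : 0 < r) (hs : ∀ c ∈ s, ‖c‖ ≤ 1)
    (h : ∀ c ∈ s, ∀ d ∈ s, c ≠ d → r ≤ ‖c - d‖) :
    (s.card : ℝ) ≤ (1 + 2 / r) ^ Module.finrank ℝ E := by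
  borelize E
  let μ : Measure E := Measure.addHaar
  have ρpos : 0 < r / 2 + 1 := by positivity
  have δpos : 0 < r / 2 := by positivity
  set A := ⋃ c ∈ s, ball (c : E) (r / 2) with hA
  have D : Set.Pairwise (s : Set E) (Function.onFun Disjoint fun c => ball (c : E) (r / 2)) := by
    rintro c hc d hd hcd
    apply ball_disjoint_ball
    rw [dist_eq_norm]
    have := h c hc d hd hcd
    linarith
  have A_subset : A ⊆ ball (0 : E) (r / 2 + 1) := by
    refine Set.iUnion₂_subset fun x hx => ?_
    apply ball_subset_ball'
    rw [dist_zero_right]; exact add_le_add le_rfl (hs x hx)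
  have I :
    (s.card : ENNReal) * ENNReal.ofReal ((r / 2) ^ Module.finrank ℝ E) * μ (ball 0 1) ≤
      ENNReal.ofReal ((r / 2 + 1) ^ Module.finrank ℝ E) * μ (ball 0 1) :=
    calc
      _ = μ A := by
        rw [hA, measure_biUnion_finset D fun c _ => measurableSet_ball]
        simp only [μ.addHaar_ball_of_pos _ δpos]
        simp only [Finset.sum_const, nsmul_eq_mul, mul_assoc]
      _ ≤ μ (ball (0 : E) (r / 2 + 1)) := measure_mono A_subset
      _ = _ := by
        simp only [μ.addHaar_ball_of_pos _ ρpos]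
  have J : (s.card : ENNReal) * ENNReal.ofReal ((r / 2) ^ Module.finrank ℝ E) ≤
      ENNReal.ofReal ((r / 2 + 1) ^ Module.finrank ℝ E) :=
    (ENNReal.mul_le_mul_iff_left (measure_ball_pos _ _ zero_lt_one).ne' measure_ball_lt_top.ne).1 I
  have K := ENNReal.toReal_le_of_le_ofReal (pow_nonneg ρpos.le _) J
  rw [ENNReal.toReal_mul, ENNReal.toReal_natCast, ENNReal.toReal_ofReal (by positivity)] at K
  rw [← le_div_iff₀ (by positivity), ← div_pow] at K
  refine K.trans (le_of_eq ?_)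
  congr 1
  field_simp

theorem geom {d n : ℕ} (hd : 0 < d) (hnd : n ≤ d) (A : ℕ) (hA : 1 ≤ A) (R : ℕ)
    (hR : 3 ^ (d - 1) * (5 * A * d) ^ n < R) (e : Fin n → Fin d → ℝ) (he : ∀ i j, |e i j| ≤ A)
    (Q : ℕ) (hQ : 0 < Q) (δ : Fin n → ℝ) (hδ0 : ∀ i, 0 < δ i) (hδQ : ∀ i, δ i ≤ Q)
    (L : ℝ) (hL0 : 0 < L) (hL1 : L ≤ 1)
    (hvol : 1 ≤ (Q:ℝ) ^ (d - n) * (∏ i, δ i) * L ^ (d - 1))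
    (hno : ∀ q : Fin d → ℤ, q ≠ 0 → ‖q‖ ≤ Q * L → ∃ i, δ i * L < |∑ j, (q j : ℝ) * e i j|) :
    ∃ p : Fin d → Fin d → ℤ, LinearIndependent ℝ (fun j i => (p j i : ℝ)) ∧
      ∀ j, ‖p j‖ ≤ R * Q ∧ ∀ i, |∑ k, (p j k : ℝ) * e i k| ≤ R * δ i := by
  classical
  have hR0 : 0 < R := by omega
  have hR0' : (1:ℝ) ≤ R := by exact_mod_cast hR0
  have hQ' : (0:ℝ) < Q := by exact_mod_cast hQ
  have hd' : (1:ℝ) ≤ d := by exact_mod_cast hd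
  have hA' : (1:ℝ) ≤ A := by exact_mod_cast hA
  set D : Set (Fin d → ℝ) := {v | ∃ q : Fin d → ℤ, (v = fun i => (q i : ℝ)) ∧ ‖q‖ ≤ R * Q ∧
    ∀ i, |∑ k, (q k : ℝ) * e i k| ≤ R * δ i} with hD
  by_cases htop : Submodule.span ℝ D = ⊤
  · obtain ⟨f, hf1, -, hf3⟩ := Submodule.exists_fun_fin_finrank_span_eq ℝ D
    have hfr : Module.finrank ℝ (Submodule.span ℝ D) = d := by
      rw [htop, finrank_top]; simp
    choose p hp1 hp2 hp3 using hf1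
    refine ⟨fun j => p (Fin.cast hfr.symm j), ?_, fun j => ⟨hp2 _, hp3 _⟩⟩
    have := hf3.comp (Fin.cast hfr.symm) (Fin.cast_injective _)
    have h2 : (f ∘ Fin.cast hfr.symm) = fun j i => (p (Fin.cast hfr.symm j) i : ℝ) := by
      funext j
      exact hp1 _
    rw [h2] at this
    exact this
  exfalso
  set H := Submodule.span ℝ D with hH
  -- pigeonhole
  set s : Finset (Fin d → ℤ) := Finset.Icc (fun _ => 0) (fun _ => ((R * Q : ℕ) : ℤ)) with hs
  set a : Fin n → ℕ := fun i => ⌈A * d * Q / δ i⌉₊ with ha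
  set t : Finset (Fin n → ℤ) := Finset.Icc (fun i => -(a i : ℤ)) (fun i => (a i : ℤ)) with ht
  set f : (Fin d → ℤ) → (Fin n → ℤ) := fun q i => ⌊(∑ j, (q j : ℝ) * e i j) / (R * δ i)⌋ with hf
  have hscard : (s.card : ℝ) = (R * Q + 1 : ℝ) ^ d := by
    simp only [hs, Pi.card_Icc, Int.card_Icc]
    rw [Finset.prod_const]
    simp
    congr 1
    have : ((R:ℤ) * Q + 1).toNat = R * Q + 1 := by
      have : ((R:ℤ) * Q + 1) = ((R * Q + 1 : ℕ) : ℤ) := by push_cast; ring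
      rw [this, Int.toNat_natCast]
    rw [this]; push_cast; ring
  have htcard : (t.card : ℝ) ≤ ∏ i, (5 * A * d * Q / δ i) := by
    simp only [ht, Pi.card_Icc, Int.card_Icc]
    rw [Nat.cast_prod]
    apply Finset.prod_le_prod
    · intro i _; positivity
    · intro i _
      have h0 := hδ0 i
      have h1 : ((a i : ℤ) + 1 - -(a i:ℤ)).toNat = 2 * a i + 1 := by omega
      rw [h1]
      have h2 : (a i : ℝ) ≤ A * d * Q / δ i + 1 := (Nat.ceil_lt_add_one (by positivity)).le
      have h3 : 1 ≤ A * d * Q / δ i := by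
        rw [le_div_iff₀ h0, one_mul]
        calc δ i ≤ Q := hδQ i
          _ = 1 * 1 * Q := by ring
          _ ≤ A * d * Q := by gcongr
      have h4 : 5 * A * d * Q / δ i = 5 * (A * d * Q / δ i) := by ring
      rw [h4]
      push_cast
      linarith
  have htne : t.Nonempty := by
    refine ⟨0, ?_⟩
    simp [ht, Pi.le_def]
  have hmaps : ∀ q ∈ s, f q ∈ t := by
    intro q hq
    have hq' : ∀ j, |(q j : ℝ)| ≤ R * Q := by
      intro j
      simp only [hs, Finset.mem_Icc, Pi.le_def] at hq
      have h1 := hq.1 j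
      have h2 := hq.2 j
      have h1' : (0:ℝ) ≤ q j := by exact_mod_cast h1
      rw [abs_of_nonneg h1']
      exact_mod_cast h2
    have hb : ∀ i, |(∑ j, (q j : ℝ) * e i j) / (R * δ i)| ≤ a i := by
      intro i
      have h0 := hδ0 i
      rw [abs_div, abs_of_pos (by positivity : (0:ℝ) < R * δ i)]
      refine le_trans ?_ (Nat.le_ceil _)
      rw [div_le_div_iff₀ (by positivity) h0]
      have : |∑ j, (q j : ℝ) * e i j| ≤ d * (R * Q * A) := by
        refine (Finset.abs_sum_le_sum_abs _ _).trans ?_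
        have : ∀ j ∈ (Finset.univ : Finset (Fin d)), |(q j : ℝ) * e i j| ≤ R * Q * A := by
          intro j _
          rw [abs_mul]
          gcongr
          · exact hq' j
          · exact he i j
        refine (Finset.sum_le_card_nsmul _ _ _ this).trans ?_
        simp
      calc _ ≤ d * (R * Q * A) * δ i := by gcongr
        _ = _ := by ring
    simp only [ht, hf, Finset.mem_Icc, Pi.le_def]
    constructor <;> intro i <;> have := abs_le.1 (hb i)
    · rw [Int.le_floor]; push_cast; exact this.1
    · exact_mod_cast (Int.floor_le _).trans this.2
  obtain ⟨y, -, hy⟩ := Finset.exists_le_card_fiber_of_nsmul_le_card_of_maps_to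
    (M := ℝ) (b := s.card / t.card) hmaps htne (by
      have : (0:ℝ) < t.card := by exact_mod_cast htne.card_pos
      rw [nsmul_eq_mul]; apply le_of_eq; field_simp)
  set S := {x ∈ s | f x = y} with hS
  have htpos : (0:ℝ) < t.card := by exact_mod_cast htne.card_pos
  have hspos : (0:ℝ) < s.card := by rw [hscard]; positivity
  have hSne : S.Nonempty := by
    rw [← Finset.card_pos]
    have : (0:ℝ) < S.card := lt_of_lt_of_le (by positivity) hy
    exact_mod_cast this
  obtain ⟨s0, hs0⟩ := hSne
  -- differences
  have hdiff : ∀ p ∈ S, ∀ q ∈ S, ‖p - q‖ ≤ R * Q ∧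
      ∀ i, |∑ k, ((p - q) k : ℝ) * e i k| ≤ R * δ i := by
    intro p hp q hq
    obtain ⟨hp1, hp2⟩ := Finset.mem_filter.1 hp
    obtain ⟨hq1, hq2⟩ := Finset.mem_filter.1 hq
    constructor
    · rw [pi_norm_le_iff_of_nonneg (by positivity)]
      intro j
      simp only [hs, Finset.mem_Icc, Pi.le_def] at hp1 hq1
      have h1 := hp1.1 j
      have h2 := hp1.2 j
      have h3 := hq1.1 j
      have h4 := hq1.2 j
      have : |p j - q j| ≤ ((R * Q : ℕ) : ℤ) := abs_le.2 ⟨by linarith, by linarith⟩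
      rw [Int.norm_eq_abs]
      exact_mod_cast this
    · intro i
      have h0 := hδ0 i
      have h1 : f p i = f q i := by rw [hp2, hq2]
      simp only [hf] at h1
      have h2 := Int.abs_sub_lt_one_of_floor_eq_floor h1
      rw [← sub_div, abs_div, abs_of_pos (by positivity : (0:ℝ) < R * δ i), div_lt_one (by positivity)] at h2
      refine le_trans (le_of_eq ?_) h2.le
      rw [← Finset.sum_sub_distrib]
      congr 1
      apply Finset.sum_congr rfl
      intro j _
      simp; ring
  -- the scaling map
  let T : (Fin d → ℝ) →ₗ[ℝ] (Fin d → ℝ) × (Fin n → ℝ) :=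
    { toFun := fun v => (fun j => v j / (R * Q), fun i => (∑ k, v k * e i k) / (R * δ i))
      map_add' := by
        intro v w
        ext j
        · simp; ring
        · simp [add_mul, Finset.sum_add_distrib, add_div]
      map_smul' := by
        intro c v
        ext j
        · simp; ring
        · simp [mul_assoc, ← Finset.mul_sum, mul_div_assoc] }
  have hT1 : ∀ v, (T v).1 = fun j => v j / (R * Q) := fun v => rfl
  have hT2 : ∀ v, (T v).2 = fun i => (∑ k, v k * e i k) / (R * δ i) := fun v => rfl
  let cst : (Fin d → ℤ) → (Fin d → ℝ) := fun q j => (q j : ℝ)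
  have hcsub : ∀ p q, cst (p - q) = cst p - cst q := by
    intro p q; ext j; simp [cst]
  have hmemH : ∀ p ∈ S, cst (p - s0) ∈ H := by
    intro p hp
    apply Submodule.subset_span
    exact ⟨p - s0, rfl, hdiff p hp s0 hs0⟩
  have hTnorm : ∀ p ∈ S, ∀ q ∈ S, ‖T (cst (p - q))‖ ≤ 1 := by
    intro p hp q hq
    obtain ⟨h1, h2⟩ := hdiff p hp q hq
    rw [Prod.norm_def, max_le_iff, hT1, hT2, pi_norm_le_iff_of_nonneg zero_le_one,
      pi_norm_le_iff_of_nonneg zero_le_one]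
    constructor
    · intro j
      rw [Real.norm_eq_abs, abs_div, abs_of_pos (by positivity : (0:ℝ) < R * Q), div_le_one (by positivity)]
      have := (norm_le_pi_norm (p - q) j).trans h1
      rw [Int.norm_eq_abs] at this
      exact this
    · intro i
      have h0 := hδ0 i
      rw [Real.norm_eq_abs, abs_div, abs_of_pos (by positivity : (0:ℝ) < R * δ i), div_le_one (by positivity)]
      exact h2 i
  have hTsep : ∀ p q, p ≠ q → L / R ≤ ‖T (cst (p - q))‖ := by
    intro p q hpq
    by_contra! hlt
    rw [Prod.norm_def, max_lt_iff, hT1, hT2, pi_norm_lt_iff (by positivity),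
      pi_norm_lt_iff (by positivity)] at hlt
    obtain ⟨h1, h2⟩ := hlt
    obtain ⟨i, hi⟩ := hno (p - q) (sub_ne_zero.2 hpq) (by
      rw [pi_norm_le_iff_of_nonneg (by positivity)]
      intro j
      have := h1 j
      rw [Real.norm_eq_abs, abs_div, abs_of_pos (by positivity : (0:ℝ) < R * Q),
        div_lt_div_iff₀ (by positivity) (by positivity)] at this
      rw [Int.norm_eq_abs]
      have h3 : |cst (p - q) j| < L * Q := by
        have : |cst (p - q) j| * R < (L * Q) * R := by linarith
        exact lt_of_mul_lt_mul_right this (by positivity)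
      rw [mul_comm]
      exact h3.le)
    have h0 := hδ0 i
    have := h2 i
    rw [Real.norm_eq_abs, abs_div, abs_of_pos (by positivity : (0:ℝ) < R * δ i),
        div_lt_div_iff₀ (by positivity) (by positivity)] at this
    have h3 : |∑ k, cst (p - q) k * e i k| < L * δ i := by
      have : |∑ k, cst (p - q) k * e i k| * R < (L * δ i) * R := by linarith
      exact lt_of_mul_lt_mul_right this (by positivity)
    have h4 : |∑ k, cst (p - q) k * e i k| = |∑ j, ((p - q) j : ℝ) * e i j| := rfl
    linarith
  let V := H.map T
  let g : {x // x ∈ S} → V := fun p => ⟨T (cst (p.1 - s0)), Submodule.mem_map_of_mem (hmemH p.1 p.2)⟩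
  have hg : ∀ p q, ‖g p - g q‖ = ‖T (cst (p.1 - q.1))‖ := by
    intro p q
    rw [Submodule.coe_norm]
    simp only [g, Submodule.coe_sub]
    rw [← map_sub, hcsub, hcsub, hcsub, sub_sub_sub_cancel_right]
  have hginj : Function.Injective g := by
    intro p q hpq
    by_contra hne
    have h1 := hTsep p.1 q.1 (fun h => hne (Subtype.ext h))
    rw [← hg, hpq, sub_self, norm_zero] at h1
    have : 0 < L / R := by positivity
    linarith
  have hpack := packing (S.attach.image g) (L / R) (by positivity) (by
      intro c hc
      obtain ⟨p, -, rfl⟩ := Finset.mem_image.1 hc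
      exact hTnorm p.1 p.2 s0 hs0) (by
      intro c hc c' hc' hne
      obtain ⟨p, -, rfl⟩ := Finset.mem_image.1 hc
      obtain ⟨q, -, rfl⟩ := Finset.mem_image.1 hc'
      rw [hg]
      exact hTsep _ _ (fun h => hne (by rw [Subtype.ext h])))
  rw [Finset.card_image_of_injective _ hginj, Finset.card_attach] at hpack
  have hfin : Module.finrank ℝ V ≤ d - 1 := by
    have h1 : Module.finrank ℝ V ≤ Module.finrank ℝ H := Submodule.finrank_map_le T H
    have h2 : Module.finrank ℝ H < Module.finrank ℝ (Fin d → ℝ) := Submodule.finrank_lt htop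
    simp at h2
    omega
  have hup : (S.card : ℝ) ≤ (3 * R / L) ^ (d - 1) := by
    have hRL : 1 ≤ R / L := by rw [le_div_iff₀ hL0]; linarith
    refine hpack.trans ?_
    have e1 : 2 / (L / R) = 2 * (R / L) := by field_simp
    have e2 : 3 * R / L = 3 * (R / L) := by ring
    rw [e1, e2]
    calc _ ≤ (1 + 2 * (R / L)) ^ (d - 1) := pow_le_pow_right₀ (by linarith) hfin
      _ ≤ _ := by gcongr; linarith
  have hprodpos : 0 < ∏ i, δ i := Finset.prod_pos fun i _ => hδ0 i
  have hlow : (R:ℝ) ^ d * Q ^ d ≤ (3 * R / L) ^ (d - 1) * ∏ i, (5 * A * d * Q / δ i) := by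
    calc (R:ℝ) ^ d * Q ^ d = (R * Q) ^ d := by rw [mul_pow]
      _ ≤ (R * Q + 1 : ℝ) ^ d := by gcongr; linarith
      _ = s.card := hscard.symm
      _ = (s.card / t.card) * t.card := by field_simp
      _ ≤ (3 * R / L) ^ (d - 1) * ∏ i, (5 * A * d * Q / δ i) := by
        apply mul_le_mul (hy.trans hup) htcard htpos.le (by positivity)
  rw [Finset.prod_div_distrib, Finset.prod_const, Finset.card_univ, Fintype.card_fin] at hlow
  obtain ⟨r, rfl⟩ : ∃ r, d = r + 1 := ⟨d - 1, by omega⟩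
  obtain ⟨u, hu⟩ : ∃ u, r + 1 = n + u := ⟨r + 1 - n, by omega⟩
  have hu' : r + 1 - n = u := by omega
  rw [hu'] at hvol
  simp only [Nat.add_sub_cancel] at hvol hlow hR
  have hR' : (3:ℝ) ^ r * (5 * A * (r + 1 : ℕ)) ^ n < R := by exact_mod_cast hR
  have key : (R:ℝ) ^ (r+1) * Q ^ (r+1) * (L ^ r * ∏ i, δ i) ≤
      3 ^ r * R ^ r * ((5 * A * (r + 1 : ℕ)) ^ n * Q ^ n) := by
    calc _ ≤ ((3 * R / L) ^ r * ((5 * A * (r + 1 : ℕ) * Q) ^ n / ∏ i, δ i)) * (L ^ r * ∏ i, δ i) := by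
          gcongr
      _ = _ := by
          rw [div_pow, mul_pow, mul_pow]
          field_simp
  have hQn : (Q:ℝ) ^ (r+1) = Q ^ n * Q ^ u := by rw [hu, pow_add]
  rw [hQn] at key
  have h5 : (R:ℝ) ^ r * Q ^ n * R ≤ (R:ℝ) ^ r * Q ^ n * (3 ^ r * (5 * A * (r + 1 : ℕ)) ^ n) := by
    calc _ = (R:ℝ) ^ r * Q ^ n * R * 1 := by ring
      _ ≤ (R:ℝ) ^ r * Q ^ n * R * ((Q:ℝ) ^ u * (∏ i, δ i) * L ^ r) := by gcongr
      _ = (R:ℝ) ^ (r+1) * (Q ^ n * Q ^ u) * (L ^ r * ∏ i, δ i) := by ring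
      _ ≤ _ := key
      _ = _ := by ring
  have h6 := le_of_mul_le_mul_left h5 (by positivity)
  linarith


theorem prod_dy {d n : ℕ} (hnd : n < d) (t γ : Fin n → ℝ) (hts : ∑ i, t i = (d:ℝ) - n) (k : ℕ)
    (hk : 0 < k) :
    ((2:ℝ) ^ k) ^ (d - n) * ∏ i, ((2:ℝ) ^ (-(k * t i)) * (k:ℝ) ^ (γ i)) = (k:ℝ) ^ (∑ i, γ i) := by
  have hk' : (0:ℝ) < k := by exact_mod_cast hk
  rw [Finset.prod_mul_distrib, ← Real.rpow_sum_of_pos (by norm_num), ← Real.rpow_sum_of_pos hk',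
    Finset.sum_neg_distrib, ← Finset.mul_sum, hts, ← mul_assoc, ← Real.rpow_natCast, ← Real.rpow_natCast,
    ← Real.rpow_mul (by norm_num), ← Real.rpow_add (by norm_num), Nat.cast_sub hnd.le]
  simp

theorem ev_small (t β : ℝ) (ht : 0 < t) :
    ∀ᶠ k : ℕ in atTop, (2:ℝ) ^ (-(k * t)) * (k:ℝ) ^ β ≤ (2:ℝ) ^ k := by
  have h := (tendsto_rpow_mul_exp_neg_mul_atTop_nhds_zero β (Real.log 2)
    (Real.log_pos (by norm_num))).comp tendsto_natCast_atTop_atTop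
  filter_upwards [h.eventually (eventually_le_nhds (zero_lt_one)), eventually_gt_atTop 0] with k hk hk0
  have h1 : (2:ℝ) ^ (-(k * t)) ≤ 1 :=
    Real.rpow_le_one_of_one_le_of_nonpos (by norm_num) (by
      have : (0:ℝ) ≤ k := by positivity
      nlinarith)
  have h2 : (k:ℝ) ^ β ≤ 2 ^ k := by
    simp only [Function.comp] at hk
    rw [neg_mul, Real.exp_neg, ← div_eq_mul_inv, div_le_one (Real.exp_pos _)] at hk
    refine hk.trans (le_of_eq ?_)
    rw [mul_comm, Real.exp_nat_mul, Real.exp_log (by norm_num)]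
  calc _ ≤ 1 * (k:ℝ) ^ β := by gcongr
    _ ≤ _ := by rw [one_mul]; exact h2

theorem dyadic {d n : ℕ} (hnd : n < d) (t β : Fin n → ℝ) (ε : ℝ) (hε : 0 < ε)
    (ht : ∀ i, 0 < t i) (hts : ∑ i, t i = (d:ℝ) - n) (hβ : ∑ i, β i = (1 + ε) * ((d : ℝ) - 1)) :
    ∀ᵐ e : Fin n → Fin d → ℝ, ∃ R : ℕ, 0 < R ∧ ∀ᶠ k : ℕ in atTop,
      ∃ p : Fin d → Fin d → ℤ, LinearIndependent ℝ (fun j i => (p j i : ℝ)) ∧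
        ∀ j, ‖p j‖ ≤ R * 2 ^ k ∧ ∀ i,
          (2:ℝ) ^ (-(k * t i)) * (k:ℝ) ^ (β i - (1 + ε) * d) ≤ |∑ l, (p j l : ℝ) * e i l| ∧
          |∑ l, (p j l : ℝ) * e i l| ≤ R * ((2:ℝ) ^ (-(k * t i)) * (k:ℝ) ^ (β i)) := by
  have hsumm : Summable fun k : ℕ => (k:ℝ) ^ (-(1 + ε)) := Real.summable_nat_rpow.2 (by linarith)
  have B1 := bc (n := n) hnd (fun k => 2 ^ k * (k:ℝ) ^ (-(1 + ε)))
    (fun k i => (2:ℝ) ^ (-(k * t i)) * (k:ℝ) ^ (β i - (1 + ε)))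
    (fun k => by positivity) (fun k i => by positivity) (by
      refine hsumm.congr_cofinite ?_
      rw [Nat.cofinite_eq_atTop]
      filter_upwards [eventually_gt_atTop 0] with k hk
      have hk' : (0:ℝ) < k := by exact_mod_cast hk
      rw [mul_pow, mul_right_comm, prod_dy hnd t _ hts k hk, ← Real.rpow_natCast, ← Real.rpow_mul hk'.le,
        ← Real.rpow_add hk']
      congr 1
      rw [Finset.sum_sub_distrib, hβ, Nat.cast_sub hnd.le]
      simp
      ring)
  have B2 : ∀ i0 : Fin n, ∀ R : ℕ, ∀ᵐ e : Fin n → Fin d → ℝ, ∀ᶠ k : ℕ in atTop, ∀ q : Fin d → ℤ, q ≠ 0 →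
      ‖q‖ ≤ R * 2 ^ k → ∃ i, R * ((2:ℝ) ^ (-(k * t i)) *
        (k:ℝ) ^ (β i - if i = i0 then (1 + ε) * d else 0)) < |∑ j, (q j : ℝ) * e i j| := by
    intro i0 R
    refine bc (n := n) hnd (fun k => R * 2 ^ k)
      (fun k i => R * ((2:ℝ) ^ (-(k * t i)) * (k:ℝ) ^ (β i - if i = i0 then (1 + ε) * d else 0)))
      (fun k => by positivity) (fun k i => by positivity) ?_
    refine (hsumm.mul_left ((R:ℝ) ^ (d - n) * R ^ n)).congr_cofinite ?_
    rw [Nat.cofinite_eq_atTop]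
    filter_upwards [eventually_gt_atTop 0] with k hk
    have hk' : (0:ℝ) < k := by exact_mod_cast hk
    rw [Finset.prod_mul_distrib, mul_pow, mul_mul_mul_comm, prod_dy hnd t _ hts k hk]
    simp only [Finset.prod_const, Finset.card_univ, Fintype.card_fin]
    congr 2
    rw [Finset.sum_sub_distrib, hβ]
    simp
    ring
  filter_upwards [B1, ae_all_iff.2 (fun i0 => ae_all_iff.2 (B2 i0))] with e h1 h2
  obtain ⟨A, hA⟩ := exists_nat_ge (max ‖e‖ 1)
  have hA1 : 1 ≤ A := by exact_mod_cast (le_max_right _ _).trans hA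
  have hAe : ∀ i j, |e i j| ≤ A := fun i j =>
    ((norm_le_pi_norm (e i) j).trans (norm_le_pi_norm e i)).trans ((le_max_left _ _).trans hA)
  set R := 3 ^ (d - 1) * (5 * A * d) ^ n + 1 with hR
  refine ⟨R, by omega, ?_⟩
  filter_upwards [h1, eventually_all.2 (fun i0 => h2 i0 R), eventually_gt_atTop 0,
    eventually_all.2 (fun i => ev_small (t i) (β i) (ht i))] with k k1 k2 hk k3
  have hk' : (0:ℝ) < k := by exact_mod_cast hk
  have hk1 : (1:ℝ) ≤ k := by exact_mod_cast hk
  obtain ⟨p, hp, hp'⟩ := geom (by omega) hnd.le A hA1 R (by omega) e hAe (2 ^ k) (by positivity)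
    (fun i => (2:ℝ) ^ (-(k * t i)) * (k:ℝ) ^ (β i)) (fun i => by positivity)
    (by push_cast; exact k3) ((k:ℝ) ^ (-(1 + ε))) (by positivity)
    (Real.rpow_le_one_of_one_le_of_nonpos hk1 (by linarith)) (by
      push_cast
      rw [prod_dy hnd t _ hts k hk, ← Real.rpow_natCast, ← Real.rpow_mul hk'.le, ← Real.rpow_add hk', hβ,
        Nat.cast_sub (by omega)]
      apply le_of_eq
      symm
      push_cast
      rw [show (1 + ε) * ((d:ℝ) - 1) + -(1 + ε) * ((d:ℝ) - 1) = 0 by ring, Real.rpow_zero]) (by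
      intro q hq hqn
      push_cast at hqn
      obtain ⟨i, hi⟩ := k1 q hq hqn
      refine ⟨i, lt_of_le_of_lt (le_of_eq ?_) hi⟩
      rw [mul_assoc, ← Real.rpow_add hk', sub_eq_add_neg])
  refine ⟨p, hp, fun j => ⟨by simpa using (hp' j).1, fun i => ⟨?_, (hp' j).2 i⟩⟩⟩
  have hpj : p j ≠ 0 := by
    intro h
    apply hp.ne_zero j
    funext l
    simp [h]
  obtain ⟨i', hi'⟩ := k2 i (p j) hpj (by simpa using (hp' j).1)
  by_cases hii : i' = i
  · subst hii
    simp only [if_true] at hi'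
    have hR1 : (1:ℝ) ≤ R := by exact_mod_cast (by omega : 1 ≤ R)
    refine le_trans ?_ hi'.le
    refine le_mul_of_one_le_left (by positivity) hR1
  · exfalso
    have := (hp' j).2 i'
    simp only [if_neg hii, sub_zero] at hi'
    linarith

theorem ratstruct {m d : ℕ} (F : Submodule ℝ (Fin m → ℝ)) (hF : DefinedOverQ F)
    (hd : d = Module.finrank ℝ F) :
    ∃ (κ : Type) (_ : Fintype κ) (b : Fin d ⊕ κ → Fin m → ℝ) (w : Fin d ⊕ κ → Fin m → ℤ) (ρ : ℝ),
      ρ ≠ 0 ∧ LinearIndependent ℝ b ∧ Submodule.span ℝ (Set.range (fun j => b (Sum.inl j))) = F ∧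
      Fintype.card (Fin d ⊕ κ) = m ∧
      (∀ l, ∑ k, (w l k : ℝ) * b l k = ρ) ∧ (∀ l j, l ≠ j → ∑ k, (w l k : ℝ) * b j k = 0) := by
  classical
  obtain ⟨B, hB, rfl⟩ := hF
  subst hd
  obtain ⟨f, hf1, hf2, hf3⟩ := Submodule.exists_fun_fin_finrank_span_eq ℝ B
  set t : Set (Fin m → ℝ) := {v | ∀ i, ∃ a : ℚ, v i = (a : ℝ)} with ht
  have hft : Set.range f ⊆ t := by
    rintro _ ⟨i, rfl⟩
    exact hB _ (hf1 i)
  have hfi : LinearIndepOn ℝ id (Set.range f) := hf3.linearIndepOn_id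
  obtain ⟨b, hbt, hfb, htb, hbi⟩ := exists_linearIndepOn_extension hfi hft
  simp only [Set.image_id] at htb
  have htop : Submodule.span ℝ b = ⊤ := by
    rw [eq_top_iff, ← (Pi.basisFun ℝ (Fin m)).span_eq, Submodule.span_le]
    rintro _ ⟨i, rfl⟩
    apply htb
    intro j
    refine ⟨if j = i then 1 else 0, ?_⟩
    simp only [Pi.basisFun_apply, Pi.single_apply]
    split_ifs <;> simp
  have hbfin : b.Finite := LinearIndependent.setFinite hbi
  have hκfin : (b \ Set.range f).Finite := hbfin.subset Set.sdiff_subset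
  let eb : Fin _ ⊕ Fin hκfin.toFinset.card → Fin m → ℝ :=
    Sum.elim f (fun c => ((hκfin.toFinset.equivFin.symm c : _) : Fin m → ℝ))
  have hmem : ∀ c, ((hκfin.toFinset.equivFin.symm c : _) : Fin m → ℝ) ∈ b \ Set.range f := fun c =>
    hκfin.mem_toFinset.1 (hκfin.toFinset.equivFin.symm c).2
  have hinj : Function.Injective eb := by
    refine Function.Injective.sumElim hf3.injective ?_ ?_
    · exact Subtype.val_injective.comp (Equiv.injective _)
    · intro a c h
      exact (hmem c).2 ⟨a, h⟩
  have hrange : Set.range eb = b := by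
    rw [Set.Sum.elim_range]
    ext v
    constructor
    · rintro (h | ⟨c, rfl⟩)
      · exact hfb h
      · exact (hmem c).1
    · intro hv
      by_cases h : v ∈ Set.range f
      · exact Or.inl h
      · right
        refine ⟨hκfin.toFinset.equivFin ⟨v, hκfin.mem_toFinset.2 ⟨hv, h⟩⟩, ?_⟩
        simp
  have hebi : LinearIndependent ℝ eb := by
    rw [← linearIndepOn_id_range_iff hinj, hrange]
    exact hbi
  have hcard : Fintype.card (Fin (Module.finrank ℝ (Submodule.span ℝ B)) ⊕ Fin hκfin.toFinset.card) = m := by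
    have := finrank_span_eq_card hebi
    rw [hrange, htop, finrank_top] at this
    rw [← this]; simp
  have hrat : ∀ l k, ∃ a : ℚ, eb l k = (a : ℝ) := by
    intro l
    have : eb l ∈ b := hrange ▸ ⟨l, rfl⟩
    exact hbt this
  choose a ha using hrat
  obtain ⟨⟨D, hD⟩, hDi⟩ := IsLocalization.exist_integer_multiples_of_finite (nonZeroDivisors ℤ)
    (fun lk : (Fin (Module.finrank ℝ (Submodule.span ℝ B)) ⊕ Fin hκfin.toFinset.card) × Fin m => a lk.1 lk.2)
  have hD0 : (D:ℝ) ≠ 0 := by exact_mod_cast nonZeroDivisors.ne_zero hD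
  choose z hz using hDi
  have hz' : ∀ l k, (z (l, k) : ℝ) = D * eb l k := by
    intro l k
    have := hz (l, k)
    simp at this
    rw [ha]
    exact_mod_cast this
  let e := Fintype.equivFinOfCardEq hcard
  let Z : Matrix (Fin m) (Fin m) ℤ := Matrix.of fun r k => z (e.symm r, k)
  have hZdet : Z.det ≠ 0 := by
    have h1 : LinearIndependent ℝ (Matrix.of (fun r k => eb (e.symm r) k) : Matrix (Fin m) (Fin m) ℝ).row :=
      hebi.comp e.symm e.symm.injective
    rw [Matrix.linearIndependent_rows_iff_isUnit, Matrix.isUnit_iff_isUnit_det, isUnit_iff_ne_zero] at h1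
    have h2 : Z.map (Int.cast : ℤ → ℝ) = (D:ℝ) • (Matrix.of (fun r k => eb (e.symm r) k) : Matrix (Fin m) (Fin m) ℝ) := by
      ext r k
      simp [Z, hz']
    have h3 : ((Z.det : ℤ) : ℝ) = (Z.map (Int.cast : ℤ → ℝ)).det := by
      have := RingHom.map_det (Int.castRingHom ℝ) Z
      simpa using this
    rw [h2, Matrix.det_smul] at h3
    intro h0
    rw [h0] at h3
    have : (D:ℝ) ^ Fintype.card (Fin m) * (Matrix.of (fun r k => eb (e.symm r) k) : Matrix (Fin m) (Fin m) ℝ).det ≠ 0 :=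
      mul_ne_zero (pow_ne_zero _ hD0) h1
    apply this
    rw [← h3]; simp
  have hdot : ∀ l j, ∑ k, (Z.adjugate k (e l) : ℝ) * eb j k = if e j = e l then (Z.det : ℝ) / D else 0 := by
    intro l j
    have h1 := congrFun (congrFun (Matrix.mul_adjugate Z) (e j)) (e l)
    rw [Matrix.mul_apply] at h1
    have h2 : ∑ k, (Z.adjugate k (e l) : ℝ) * eb j k = ((∑ k, Z (e j) k * Z.adjugate k (e l) : ℤ) : ℝ) / D := by
      push_cast
      rw [Finset.sum_div]
      apply Finset.sum_congr rfl
      intro k _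
      simp only [Z, Matrix.of_apply, Equiv.symm_apply_apply, hz']
      field_simp
    rw [h2, h1]
    by_cases h : e j = e l
    · simp [h]
    · simp [h]
  refine ⟨Fin hκfin.toFinset.card, inferInstance, eb, fun l k => Z.adjugate k (e l), (Z.det : ℝ) / D,
    div_ne_zero (by exact_mod_cast hZdet) hD0, hebi, ?_, hcard, ?_, ?_⟩
  · exact hf2
  · intro l; rw [hdot]; simp
  · intro l j hlj; rw [hdot, if_neg]; exact fun h => hlj (e.injective h).symm

theorem rpow_between (a b s : ℝ) (ha : 0 < a) (u : ℝ) (h1 : a ≤ u) (h2 : u ≤ b) :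
    min (a ^ s) (b ^ s) ≤ u ^ s ∧ u ^ s ≤ max (a ^ s) (b ^ s) := by
  have hu : 0 < u := ha.trans_le h1
  rcases le_total 0 s with hs | hs
  · exact ⟨(min_le_left _ _).trans (Real.rpow_le_rpow ha.le h1 hs),
      (Real.rpow_le_rpow hu.le h2 hs).trans (le_max_right _ _)⟩
  · exact ⟨(min_le_right _ _).trans (Real.rpow_le_rpow_of_nonpos hu h2 hs),
      (Real.rpow_le_rpow_of_nonpos ha h1 hs).trans (le_max_left _ _)⟩

theorem conv1 (θ t s : ℝ) (hθ : 0 < θ) (ht : 0 < t) : ∃ c > (0:ℝ), ∃ C > (0:ℝ), ∀ Q : ℕ, 2 ≤ Q →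
    1 ≤ ⌊θ * Real.logb 2 Q⌋₊ →
    c * ((Q:ℝ) ^ (-(θ * t)) * Real.log Q ^ s) ≤
      (2:ℝ) ^ (-((⌊θ * Real.logb 2 Q⌋₊ : ℝ) * t)) * (⌊θ * Real.logb 2 Q⌋₊ : ℝ) ^ s ∧
    (2:ℝ) ^ (-((⌊θ * Real.logb 2 Q⌋₊ : ℝ) * t)) * (⌊θ * Real.logb 2 Q⌋₊ : ℝ) ^ s ≤
      C * ((Q:ℝ) ^ (-(θ * t)) * Real.log Q ^ s) := by
  have hl2 : 0 < Real.log 2 := Real.log_pos (by norm_num)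
  set a := θ / (2 * Real.log 2) with ha
  set b := θ / Real.log 2 with hb
  have ha0 : 0 < a := by positivity
  have hb0 : 0 < b := by positivity
  refine ⟨min (a ^ s) (b ^ s), by positivity, 2 ^ t * max (a ^ s) (b ^ s), by positivity, ?_⟩
  intro Q hQ hk
  set k := ⌊θ * Real.logb 2 Q⌋₊ with hkdef
  have hQ' : (2:ℝ) ≤ Q := by exact_mod_cast hQ
  have hlQ : 0 < Real.log Q := Real.log_pos (by linarith)
  have hlogb : Real.logb 2 Q = Real.log Q / Real.log 2 := rfl
  have hX0 : 0 ≤ θ * Real.logb 2 Q := by rw [hlogb]; positivity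
  have hk1 : (k:ℝ) ≤ θ * Real.logb 2 Q := Nat.floor_le hX0
  have hk2 : θ * Real.logb 2 Q < k + 1 := Nat.lt_floor_add_one _
  have hk' : (1:ℝ) ≤ k := by exact_mod_cast hk
  have hQpow : (Q:ℝ) ^ (-(θ * t)) = (2:ℝ) ^ (-((θ * Real.logb 2 Q) * t)) := by
    rw [show -((θ * Real.logb 2 Q) * t) = Real.logb 2 Q * (-(θ * t)) by ring, Real.rpow_mul (by norm_num),
      Real.rpow_logb (by norm_num) (by norm_num) (by linarith)]
  have hXb : θ * Real.logb 2 Q = b * Real.log Q := by rw [hlogb, hb]; field_simp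
  have hab : b = 2 * a := by rw [ha, hb]; field_simp
  have hu := rpow_between a b s ha0 (k / Real.log Q) (by
      rw [le_div_iff₀ hlQ]
      rw [hXb, hab] at hk2
      nlinarith) (by
      rw [div_le_iff₀ hlQ, ← hXb]; exact hk1)
  have hks : (k:ℝ) ^ s = (k / Real.log Q) ^ s * Real.log Q ^ s := by
    rw [← Real.mul_rpow (by positivity) hlQ.le, div_mul_cancel₀ _ hlQ.ne']
  have hp1 : (Q:ℝ) ^ (-(θ * t)) ≤ (2:ℝ) ^ (-((k : ℝ) * t)) := by
    rw [hQpow]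
    apply Real.rpow_le_rpow_of_exponent_le (by norm_num)
    nlinarith
  have hp2 : (2:ℝ) ^ (-((k : ℝ) * t)) ≤ 2 ^ t * (Q:ℝ) ^ (-(θ * t)) := by
    rw [hQpow, ← Real.rpow_add (by norm_num)]
    apply Real.rpow_le_rpow_of_exponent_le (by norm_num)
    nlinarith
  rw [hks]
  constructor
  · calc _ = (Q:ℝ) ^ (-(θ * t)) * (min (a ^ s) (b ^ s) * Real.log Q ^ s) := by ring
      _ ≤ _ := by gcongr; exact hu.1
  · calc _ ≤ (2 ^ t * (Q:ℝ) ^ (-(θ * t))) * (max (a ^ s) (b ^ s) * Real.log Q ^ s) := by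
          gcongr; exact hu.2
      _ = _ := by ring

theorem conv (n : ℕ) (θ : ℝ) (t s s' : Fin n → ℝ) (hθ : 0 < θ) (ht : ∀ i, 0 < t i) :
    ∃ c > (0:ℝ), ∃ C > (0:ℝ), ∀ Q : ℕ, 2 ≤ Q → 1 ≤ ⌊θ * Real.logb 2 Q⌋₊ → ∀ i,
    c * ((Q:ℝ) ^ (-(θ * t i)) * Real.log Q ^ s i) ≤
      (2:ℝ) ^ (-((⌊θ * Real.logb 2 Q⌋₊ : ℝ) * t i)) * (⌊θ * Real.logb 2 Q⌋₊ : ℝ) ^ s i ∧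
    (2:ℝ) ^ (-((⌊θ * Real.logb 2 Q⌋₊ : ℝ) * t i)) * (⌊θ * Real.logb 2 Q⌋₊ : ℝ) ^ s' i ≤
      C * ((Q:ℝ) ^ (-(θ * t i)) * Real.log Q ^ s' i) := by
  choose c hc C hC h using fun i => conv1 θ (t i) (s i) hθ (ht i)
  choose c' hc' C' hC' h' using fun i => conv1 θ (t i) (s' i) hθ (ht i)
  have hCs : ∀ i, C' i ≤ ∑ i, C' i := fun i =>
    Finset.single_le_sum (fun i _ => (hC' i).le) (Finset.mem_univ i)
  have hcs : ∀ i, 1 / c i ≤ ∑ i, 1 / c i := fun i =>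
    Finset.single_le_sum (fun i _ => (one_div_pos.2 (hc i)).le) (Finset.mem_univ i)
  have h0 : 0 ≤ ∑ i, 1 / c i := Finset.sum_nonneg fun i _ => (one_div_pos.2 (hc i)).le
  have h0' : 0 ≤ ∑ i, C' i := Finset.sum_nonneg fun i _ => (hC' i).le
  refine ⟨1 / (1 + ∑ i, 1 / c i), by positivity, 1 + ∑ i, C' i, by positivity, ?_⟩
  intro Q hQ hk i
  have hQ' : (2:ℝ) ≤ Q := by exact_mod_cast hQ
  have hlQ : 0 < Real.log Q := Real.log_pos (by linarith)
  have hci : 1 / (1 + ∑ i, 1 / c i) ≤ c i := by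
    rw [div_le_comm₀ (by positivity) (hc i)]
    linarith [hcs i]
  constructor
  · refine le_trans ?_ (h i Q hQ hk).1
    gcongr
  · refine (h' i Q hQ hk).2.trans ?_
    gcongr
    linarith [hCs i]

theorem liftindep {m d : ℕ} {κ : Type} [Fintype κ] (b : Fin d ⊕ κ → Fin m → ℝ)
    (w : Fin d ⊕ κ → Fin m → ℤ) (ρ : ℝ) (hρ : ρ ≠ 0)
    (h1 : ∀ l, ∑ k, (w l k : ℝ) * b l k = ρ)
    (h2 : ∀ l j, l ≠ j → ∑ k, (w l k : ℝ) * b j k = 0)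
    (p : Fin d → Fin d → ℤ) (hp : LinearIndependent ℝ (fun j i => (p j i : ℝ))) (j0 : Fin d)
    (q : Fin d ⊕ κ → Fin m → ℤ) (hq1 : ∀ j k, q (Sum.inl j) k = ∑ l, p j l * w (Sum.inl l) k)
    (hq2 : ∀ c k, q (Sum.inr c) k = ∑ l, p j0 l * w (Sum.inl l) k + w (Sum.inr c) k) :
    LinearIndependent ℝ (fun a k => (q a k : ℝ)) ∧
      (∀ j l, ∑ k, (q (Sum.inl j) k : ℝ) * b (Sum.inl l) k = ρ * p j l) ∧
      (∀ c l, ∑ k, (q (Sum.inr c) k : ℝ) * b (Sum.inl l) k = ρ * p j0 l) := by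
  classical
  have base : ∀ (j : Fin d) (l : Fin d ⊕ κ), ∑ k, (∑ l', (p j l' : ℝ) * w (Sum.inl l') k) * b l k =
      Sum.elim (fun l => ρ * p j l) (fun _ => 0) l := by
    intro j l
    have : ∑ k, (∑ l', (p j l' : ℝ) * w (Sum.inl l') k) * b l k =
        ∑ l', (p j l' : ℝ) * ∑ k, w (Sum.inl l') k * b l k := by
      simp_rw [Finset.sum_mul, Finset.mul_sum]
      rw [Finset.sum_comm]
      simp_rw [mul_assoc]
    rw [this]
    rcases l with l | c
    · rw [Finset.sum_eq_single l]
      · rw [h1]; simp; ring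
      · intro l' _ hne
        rw [h2 _ _ (by simpa using hne), mul_zero]
      · simp
    · simp only [Sum.elim_inr]
      apply Finset.sum_eq_zero
      intro l' _
      rw [h2 _ _ (by simp), mul_zero]
  have e1 : ∀ j l, ∑ k, (q (Sum.inl j) k : ℝ) * b l k = Sum.elim (fun l => ρ * p j l) (fun _ => 0) l := by
    intro j l
    rw [← base]
    apply Finset.sum_congr rfl
    intro k _
    rw [hq1]; push_cast; rfl
  have e2 : ∀ c l, ∑ k, (q (Sum.inr c) k : ℝ) * b l k =
      Sum.elim (fun l => ρ * p j0 l) (fun c' => if c = c' then ρ else 0) l := by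
    intro c l
    have : ∑ k, (q (Sum.inr c) k : ℝ) * b l k =
        ∑ k, (∑ l', (p j0 l' : ℝ) * w (Sum.inl l') k) * b l k + ∑ k, (w (Sum.inr c) k : ℝ) * b l k := by
      rw [← Finset.sum_add_distrib]
      apply Finset.sum_congr rfl
      intro k _
      rw [hq2]; push_cast; ring
    rw [this, base]
    rcases l with l | c'
    · rw [h2 _ _ (by simp)]; simp
    · by_cases hcc : c = c'
      · subst hcc; rw [h1]; simp
      · rw [h2 _ _ (by simpa using hcc)]; simp [hcc]
  refine ⟨?_, fun j l => by simpa using e1 j (Sum.inl l), fun c l => by simpa using e2 c (Sum.inl l)⟩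
  rw [Fintype.linearIndependent_iff]
  intro g hg
  have hdot : ∀ l, ∑ a, g a * ∑ k, (q a k : ℝ) * b l k = 0 := by
    intro l
    have : ∑ a, g a * ∑ k, (q a k : ℝ) * b l k = ∑ k, (∑ a, g a * q a k) * b l k := by
      simp_rw [Finset.sum_mul, Finset.mul_sum]
      rw [Finset.sum_comm]
      simp_rw [mul_assoc]
    rw [this]
    apply Finset.sum_eq_zero
    intro k _
    have := congrFun hg k
    simp at this
    rw [Fintype.sum_sum_type, this, zero_mul]
  have hr : ∀ c, g (Sum.inr c) = 0 := by
    intro c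
    have := hdot (Sum.inr c)
    simp only [Fintype.sum_sum_type, e1, e2, Sum.elim_inr] at this
    simpa [hρ] using this
  have hl : ∀ j, g (Sum.inl j) = 0 := by
    rw [Fintype.linearIndependent_iff] at hp
    apply hp
    funext l
    have := hdot (Sum.inl l)
    simp only [Fintype.sum_sum_type, e1, e2, Sum.elim_inl, hr, zero_mul, Finset.sum_const_zero, add_zero] at this
    have h3 : ρ * ∑ j, g (Sum.inl j) * p j l = 0 := by
      rw [← this, Finset.mul_sum]
      apply Finset.sum_congr rfl
      intro j _; ring
    simpa [hρ] using h3
  rintro (j | c)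
  · exact hl j
  · exact hr c


/-- Almost every `n`-tuple of points of `F` (the tuple being parametrized, via
an arbitrary linear isomorphism `ι` onto `F`, by Lebesgue measure on
`(ℝ^d)^n` with `d = dim F`) satisfies the conclusion of Theorem `thopti`. -/
theorem stmt5 (m n : ℕ) (hn : 0 < n) (hmn : n < m)
    (F : Submodule ℝ (Fin m → ℝ)) (hF : DefinedOverQ F)
    (d : ℕ) (hd : d = Module.finrank ℝ F)
    (τ β : Fin n → ℝ) (ε : ℝ)
    (hτ : ∀ i, 0 < τ i) (hε : 0 < ε)
    (hτsum : ∑ i, τ i ≤ (d : ℝ) - n)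
    (hβ : ∑ i, β i = (1 + ε) * ((d : ℝ) - 1))
    (ι : (Fin d → ℝ) →ₗ[ℝ] (Fin m → ℝ)) (hι : Function.Injective ι)
    (hrange : LinearMap.range ι = F) :
    ∀ᵐ x ∂(volume : Measure (Fin n → Fin d → ℝ)),
      ∃ c > (0:ℝ), ∃ C > (0:ℝ), ∃ Q₀ : ℕ, ∀ Q : ℕ, Q₀ ≤ Q →
        ∃ q : Fin m → (Fin m → ℤ),
          LinearIndependent ℝ (fun j => fun i => ((q j i : ℝ))) ∧
          ∀ j, supZ (q j) ≤ C * Q ∧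
            ∀ i, c * (Q : ℝ) ^ (-(τ i)) * Real.log Q ^ (β i - (1 + ε) * d)
                  ≤ |∑ k, (q j k : ℝ) * ι (x i) k| ∧
              |∑ k, (q j k : ℝ) * ι (x i) k|
                  ≤ C * (Q : ℝ) ^ (-(τ i)) * Real.log Q ^ (β i) := by
  classical
  obtain ⟨κ, hκ, b, w, ρ, hρ, hbi, hspan, hcard, hw1, hw2⟩ := ratstruct F hF hd
  have hn' : (0:ℝ) < n := by exact_mod_cast hn
  have : Nonempty (Fin n) := ⟨⟨0, hn⟩⟩
  have hτpos : 0 < ∑ i, τ i := Finset.sum_pos (fun i _ => hτ i) Finset.univ_nonempty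
  have hdn : (0:ℝ) < (d:ℝ) - n := lt_of_lt_of_le hτpos hτsum
  have hnd : n < d := by
    have : (n:ℝ) < d := by linarith
    exact_mod_cast this
  set θ := (∑ i, τ i) / ((d:ℝ) - n) with hθ
  have hθ0 : 0 < θ := by positivity
  have hθ1 : θ ≤ 1 := by rw [hθ, div_le_one hdn]; exact hτsum
  set t : Fin n → ℝ := fun i => τ i / θ with ht
  have ht0 : ∀ i, 0 < t i := fun i => div_pos (hτ i) hθ0
  have hθt : ∀ i, θ * t i = τ i := fun i => by simp only [ht]; field_simp
  have hts : ∑ i, t i = (d:ℝ) - n := by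
    simp only [ht]
    rw [← Finset.sum_div, hθ]
    field_simp
  have hdy := dyadic hnd t β ε hε ht0 hts hβ
  obtain ⟨c0, hc0, C0, hC0, hconv⟩ := conv n θ t (fun i => β i - (1 + ε) * d) β hθ0 ht0
  -- change of coordinates
  let g : (Fin d → ℝ) →ₗ[ℝ] (Fin m → ℝ) := Fintype.linearCombination ℝ (fun j => b (Sum.inl j))
  have hbi' : LinearIndependent ℝ (fun j => b (Sum.inl j)) := hbi.comp _ Sum.inl_injective
  have hg : Function.Injective g := by
    rw [linearIndependent_iff_injective_fintypeLinearCombination] at hbi'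
    exact hbi'
  have hgr : LinearMap.range ι = LinearMap.range g := by
    rw [hrange, ← hspan]
    exact (Fintype.range_linearCombination ℝ _).symm
  let P : (Fin d → ℝ) ≃ₗ[ℝ] (Fin d → ℝ) :=
    (LinearEquiv.ofInjective ι hι) ≪≫ₗ (LinearEquiv.ofEq _ _ hgr) ≪≫ₗ (LinearEquiv.ofInjective g hg).symm
  have hP : ∀ x, g (P x) = ι x := by
    intro x
    have h1 : (LinearEquiv.ofInjective g hg) (P x) = (LinearEquiv.ofEq _ _ hgr) (LinearEquiv.ofInjective ι hι x) := by
      simp [P]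
    have h2 := congrArg Subtype.val h1
    simpa using h2
  let Φ : (Fin n → Fin d → ℝ) ≃ₗ[ℝ] (Fin n → Fin d → ℝ) := LinearEquiv.piCongrRight (fun _ => P)
  have hq := Measure.LinearMap.quasiMeasurePreserving (volume : Measure (Fin n → Fin d → ℝ)) Φ.toLinearMap
    (LinearEquiv.isUnit_det' Φ).ne_zero
  filter_upwards [hq.ae hdy] with x hx
  obtain ⟨R, hR, hev⟩ := hx
  have hΦ : ∀ i, Φ.toLinearMap x i = P (x i) := fun i => rfl
  simp only [hΦ] at hev
  have hιx : ∀ i k, ι (x i) k = ∑ l, P (x i) l * b (Sum.inl l) k := by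
    intro i k
    rw [← hP]
    simp [g, Fintype.linearCombination_apply]
  obtain ⟨W, hW⟩ : ∃ W : ℕ, ∀ l k, |(w l k : ℝ)| ≤ W := by
    obtain ⟨W, hW⟩ := exists_nat_ge ‖w‖
    refine ⟨W, fun l k => ?_⟩
    have := ((norm_le_pi_norm (w l) k).trans (norm_le_pi_norm w l)).trans hW
    rwa [Int.norm_eq_abs] at this
  have hρ' : 0 < |ρ| := abs_pos.2 hρ
  have htend : Tendsto (fun Q : ℕ => ⌊θ * Real.logb 2 Q⌋₊) atTop atTop :=
    tendsto_nat_floor_atTop.comp (Tendsto.const_mul_atTop hθ0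
      ((Real.tendsto_logb_atTop (by norm_num)).comp tendsto_natCast_atTop_atTop))
  have hfinal := (htend.eventually hev).and ((htend.eventually (eventually_ge_atTop 1)).and (eventually_ge_atTop 2))
  obtain ⟨Q₀, hQ₀⟩ := eventually_atTop.1 hfinal
  refine ⟨|ρ| * c0, by positivity, |ρ| * R * C0 + (d * R + 1) * W + 1, by positivity, Q₀, fun Q hQ => ?_⟩
  obtain ⟨⟨p, hp, hp'⟩, hk1, hQ2⟩ := hQ₀ Q hQ
  have hcv := hconv Q hQ2 hk1
  set k := ⌊θ * Real.logb 2 Q⌋₊ with hk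
  have hQ2' : (2:ℝ) ≤ Q := by exact_mod_cast hQ2
  have hlQ : 0 < Real.log Q := Real.log_pos (by linarith)
  have hkQ : (2:ℝ) ^ k ≤ Q := by
    have hlb : 0 ≤ Real.logb 2 Q := Real.logb_nonneg (by norm_num) (by linarith)
    have h1 : (k:ℝ) ≤ Real.logb 2 Q := (Nat.floor_le (by positivity)).trans (by nlinarith)
    rw [← Real.rpow_natCast]
    exact (Real.le_logb_iff_rpow_le (by norm_num) (by linarith)).1 h1
  let j0 : Fin d := ⟨0, by omega⟩
  let q' : Fin d ⊕ κ → Fin m → ℤ := Sum.elim (fun j k => ∑ l, p j l * w (Sum.inl l) k)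
    (fun c k => ∑ l, p j0 l * w (Sum.inl l) k + w (Sum.inr c) k)
  obtain ⟨hli, hd1, hd2⟩ := liftindep b w ρ hρ hw1 hw2 p hp j0 q' (fun _ _ => rfl) (fun _ _ => rfl)
  let e : Fin m ≃ Fin d ⊕ κ := (Fintype.equivFinOfCardEq hcard).symm
  refine ⟨fun j => q' (e j), hli.comp e e.injective, fun j => ?_⟩
  beta_reduce
  generalize e j = a
  have hcombo : ∃ j1, ∀ l, ∑ k, (q' a k : ℝ) * b (Sum.inl l) k = ρ * p j1 l := by
    rcases a with j | c
    · exact ⟨j, hd1 j⟩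
    · exact ⟨j0, hd2 c⟩
  have hbase : ∀ j k', |((∑ l, p j l * w (Sum.inl l) k' : ℤ) : ℝ)| ≤ d * R * W * Q := by
    intro j k'
    push_cast
    refine (Finset.abs_sum_le_sum_abs _ _).trans ?_
    have : ∀ l ∈ (Finset.univ : Finset (Fin d)), |(p j l : ℝ) * w (Sum.inl l) k'| ≤ R * Q * W := by
      intro l _
      rw [abs_mul]
      have h1 := (norm_le_pi_norm (p j) l).trans (hp' j).1
      rw [Int.norm_eq_abs] at h1
      have h2 : |(p j l : ℝ)| ≤ R * Q := h1.trans (by gcongr)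
      gcongr
      exact hW _ _
    refine (Finset.sum_le_card_nsmul _ _ _ this).trans ?_
    simp
    apply le_of_eq; ring
  have hsup : ∀ k', |(q' a k' : ℝ)| ≤ (d * R + 1) * W * Q := by
    intro k'
    rcases a with j | c
    · refine (hbase j k').trans ?_
      have : (0:ℝ) ≤ W * Q := by positivity
      nlinarith
    · have h1 := hbase j0 k'
      have h2 := hW (Sum.inr c) k'
      have h3 : (W:ℝ) ≤ W * Q := le_mul_of_one_le_right (by positivity) (by linarith)
      have h4 : (q' (Sum.inr c) k' : ℝ) = ((∑ l, p j0 l * w (Sum.inl l) k' : ℤ) : ℝ) + w (Sum.inr c) k' := by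
        simp only [q', Sum.elim_inr]; push_cast; rfl
      rw [h4]
      refine (abs_add_le _ _).trans ?_
      nlinarith
  constructor
  · rw [supZ, pi_norm_le_iff_of_nonneg (by positivity)]
    intro k'
    rw [Real.norm_eq_abs]
    refine (hsup k').trans ?_
    gcongr
    have : 0 ≤ |ρ| * R * C0 := by positivity
    linarith
  · intro i
    obtain ⟨j1, hj1⟩ := hcombo
    have hval : ∑ k, (q' a k : ℝ) * ι (x i) k = ρ * ∑ l, (p j1 l : ℝ) * P (x i) l := by
      simp_rw [hιx, Finset.mul_sum]
      rw [Finset.sum_comm]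
      apply Finset.sum_congr rfl
      intro l _
      rw [← mul_assoc, ← hj1 l, Finset.sum_mul]
      apply Finset.sum_congr rfl
      intro k _; ring
    rw [hval, abs_mul]
    obtain ⟨l1, l2⟩ := (hp' j1).2 i
    obtain ⟨m1, m2⟩ := hcv i
    rw [hθt] at m1 m2
    constructor
    · calc _ = |ρ| * (c0 * ((Q:ℝ) ^ (-(τ i)) * Real.log Q ^ (β i - (1 + ε) * d))) := by ring
        _ ≤ _ := by gcongr; exact m1.trans l1
    · have hpos : 0 ≤ (Q:ℝ) ^ (-(τ i)) * Real.log Q ^ (β i) := by positivity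
      have hpos2 : (0:ℝ) ≤ (d * R + 1) * W + 1 := by positivity
      calc _ ≤ |ρ| * (R * (C0 * ((Q:ℝ) ^ (-(τ i)) * Real.log Q ^ (β i)))) := by
            gcongr
            exact l2.trans (by gcongr)
        _ = (|ρ| * R * C0) * ((Q:ℝ) ^ (-(τ i)) * Real.log Q ^ (β i)) := by ring
        _ ≤ (|ρ| * R * C0 + (d * R + 1) * W + 1) * ((Q:ℝ) ^ (-(τ i)) * Real.log Q ^ (β i)) := by
            gcongr
            linarith
        _ = _ := by ring
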